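/- arXiv:2212.12686 — 8 statements merged into one kernel-verified Lean document; each statement's English description precedes it below -/
import Mathlib

section
/- Let $C, r, t$ be integers with $1 \leq r \leq t$ and $t \leq C - r$. Then, as an identity of rational numbers, $\frac{1}{r!\binom{C}{t}}\Big[(r-1)!\binom{C-1}{t-1} + \sum_{b=1}^{r-1} \frac{r!}{(r-b)(r-b+1)}\Big(\binom{C-1}{t-1} - \sum_{i=1}^{b}\binom{r-1}{r-i}\binom{C-r}{t-r+i-1}\Big)\Big] = \frac{t}{C} - \frac{1}{\binom{C}{t}} \sum_{i=1}^{r-1} \frac{r-i}{r}\binom{r}{i-1}\binom{C-r}{t-r+i-1}$. -/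
/-- Summation by parts against the telescoping weights `1 / ((x - b) * (x - b + 1))`. -/
theorem sum_telescoping_weights_mul_sub {K : Type*} [Field K] (x A : K) (c : ℕ → K) (n : ℕ)
    (hx : ∀ b ≤ n, x - (b : K) ≠ 0) :
    ∑ b ∈ Finset.Icc 1 n, 1 / ((x - (b : K)) * (x - (b : K) + 1)) *
        (A - ∑ i ∈ Finset.Icc 1 b, c i)
      = (A - ∑ i ∈ Finset.Icc 1 n, c i) / (x - (n : K)) - A / x
        + ∑ i ∈ Finset.Icc 1 n, c i / (x - (i : K) + 1) := by
  induction n with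
  | zero => simp
  | succ n ih =>
    have h₀ := hx n n.le_succ
    have h₁ := hx (n + 1) le_rfl
    have h₂ : x - ((n + 1 : ℕ) : K) + 1 = x - (n : K) := by push_cast; ring
    rw [Finset.sum_Icc_succ_top (by omega), ih fun b hb => hx b (hb.trans n.le_succ)]
    simp only [Finset.sum_Icc_succ_top (show 1 ≤ n + 1 by omega), h₂]
    generalize ∑ i ∈ Finset.Icc 1 n, c i = S
    have hsplit : 1 / ((x - ((n + 1 : ℕ) : K)) * (x - (n : K)))
        = 1 / (x - ((n + 1 : ℕ) : K)) - 1 / (x - (n : K)) := by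
      rw [← h₂] at h₀ ⊢
      field_simp
      ring
    rw [hsplit]
    ring

theorem choose_pred_symm_mul {r i : ℕ} (hi : 1 ≤ i) (hir : i ≤ r) :
    ((r : ℚ) - i + 1) * (r.choose (i - 1) : ℚ) = r * ((r - 1).choose (r - i) : ℚ) := by
  obtain ⟨k, rfl⟩ := Nat.exists_eq_add_of_le hir
  obtain ⟨j, rfl⟩ := Nat.exists_eq_add_of_le' hi
  have h := Nat.add_one_mul_choose_eq (j + k) k
  rw [← Nat.choose_symm_of_eq_add (show j + k + 1 = j + (k + 1) by ring)] at h
  rw [show j + 1 + k - 1 = j + k by omega, show j + 1 + k - (j + 1) = k by omega,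
    show j + 1 + k = j + k + 1 by ring, Nat.add_sub_cancel]
  have h' : ((j + k + 1 : ℕ) : ℚ) * ((j + k).choose k : ℚ)
      = ((j + k + 1).choose j : ℚ) * ((k + 1 : ℕ) : ℚ) := by exact_mod_cast h
  push_cast at h' ⊢
  linear_combination -h'

theorem choose_pred_div_choose {n k : ℕ} (hk : 1 ≤ k) (hkn : k ≤ n) :
    ((n - 1).choose (k - 1) : ℚ) / (n.choose k : ℚ) = k / n := by
  obtain ⟨n, rfl⟩ := Nat.exists_eq_add_of_le' (hk.trans hkn)
  obtain ⟨k, rfl⟩ := Nat.exists_eq_add_of_le' hk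
  have hpos : ((n + 1).choose (k + 1) : ℚ) ≠ 0 := by
    exact_mod_cast (Nat.choose_pos hkn).ne'
  have hn : ((n + 1 : ℕ) : ℚ) ≠ 0 := by positivity
  rw [div_eq_div_iff hpos hn, Nat.add_sub_cancel, Nat.add_sub_cancel, mul_comm,
    mul_comm ((k + 1 : ℕ) : ℚ)]
  exact_mod_cast Nat.add_one_mul_choose_eq n k


/-- Normalized cache memory of Scheme 1, case `t ≥ r` (equation (7) in the paper):
the round-by-round count of mini-subfiles equals the closed form of Theorem 1. -/
theorem scheme1_memory_t_ge_r (C r t : ℕ) (hr : 1 ≤ r) (hrt : r ≤ t) (htC : t + r ≤ C) :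
    (1 / ((Nat.factorial r : ℚ) * (C.choose t : ℚ))) *
      ((Nat.factorial (r - 1) : ℚ) * ((C - 1).choose (t - 1) : ℚ) +
        ∑ b ∈ Finset.Icc 1 (r - 1),
          (Nat.factorial r : ℚ) / (((r : ℚ) - (b : ℚ)) * ((r : ℚ) - (b : ℚ) + 1)) *
            (((C - 1).choose (t - 1) : ℚ) -
              ∑ i ∈ Finset.Icc 1 b,
                ((r - 1).choose (r - i) : ℚ) * ((C - r).choose (t - r + i - 1) : ℚ)))
      = (t : ℚ) / (C : ℚ) - (1 / (C.choose t : ℚ)) *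
          ∑ i ∈ Finset.Icc 1 (r - 1),
            (((r : ℚ) - (i : ℚ)) / (r : ℚ)) * (r.choose (i - 1) : ℚ) *
              ((C - r).choose (t - r + i - 1) : ℚ) := by
  have hr₀ : (r : ℚ) ≠ 0 := by exact_mod_cast (show r ≠ 0 by omega)
  have hfac : (Nat.factorial r : ℚ) = r * (Nat.factorial (r - 1) : ℚ) := by
    exact_mod_cast (Nat.mul_factorial_pred (show r ≠ 0 by omega)).symm
  have hfac₀ : (Nat.factorial (r - 1) : ℚ) ≠ 0 := by
    exact_mod_cast (Nat.factorial_pos (r - 1)).ne'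
  have hC₀ : (C.choose t : ℚ) ≠ 0 := by
    exact_mod_cast (Nat.choose_pos (show t ≤ C by omega)).ne'
  rw [← choose_pred_div_choose (hr.trans hrt) (show t ≤ C by omega)]
  generalize ((C - 1).choose (t - 1) : ℚ) = A
  set c : ℕ → ℚ := fun i =>
    ((r - 1).choose (r - i) : ℚ) * ((C - r).choose (t - r + i - 1) : ℚ) with hc
  have habel := sum_telescoping_weights_mul_sub (r : ℚ) A c (r - 1) fun b hb =>
    sub_ne_zero.mpr (by exact_mod_cast (show r ≠ b by omega))
  have hlast : (r : ℚ) - ((r - 1 : ℕ) : ℚ) = 1 := by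
    rw [Nat.cast_sub hr]
    push_cast
    ring
  rw [hlast, div_one] at habel
  have hclosed : ∑ i ∈ Finset.Icc 1 (r - 1),
      (((r : ℚ) - (i : ℚ)) / (r : ℚ)) * (r.choose (i - 1) : ℚ) *
        ((C - r).choose (t - r + i - 1) : ℚ)
      = ∑ i ∈ Finset.Icc 1 (r - 1), c i
        - ∑ i ∈ Finset.Icc 1 (r - 1), c i / ((r : ℚ) - (i : ℚ) + 1) := by
    rw [← Finset.sum_sub_distrib]
    refine Finset.sum_congr rfl fun i hi => ?_
    obtain ⟨hi₁, hi₂⟩ := Finset.mem_Icc.mp hi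
    have hir : i ≤ r := by omega
    have hpos : (r : ℚ) - i + 1 ≠ 0 := by
      have : (i : ℚ) ≤ r := by exact_mod_cast hir
      linarith
    have hchoose : (r.choose (i - 1) : ℚ)
        = r * ((r - 1).choose (r - i) : ℚ) / ((r : ℚ) - i + 1) := by
      rw [eq_div_iff hpos, mul_comm]
      exact choose_pred_symm_mul hi₁ hir
    rw [hchoose, hc]
    field_simp
    ring
  have hscale : ∑ b ∈ Finset.Icc 1 (r - 1),
      (Nat.factorial r : ℚ) / (((r : ℚ) - (b : ℚ)) * ((r : ℚ) - (b : ℚ) + 1)) *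
        (A - ∑ i ∈ Finset.Icc 1 b, c i)
      = (Nat.factorial r : ℚ) * ∑ b ∈ Finset.Icc 1 (r - 1),
        1 / (((r : ℚ) - (b : ℚ)) * ((r : ℚ) - (b : ℚ) + 1)) *
          (A - ∑ i ∈ Finset.Icc 1 b, c i) := by
    rw [Finset.mul_sum]
    exact Finset.sum_congr rfl fun b _ => by ring
  rw [hscale, habel, hclosed, hfac]
  field_simp
  ring
end

section
/- Let $C, r, t$ be integers with $1 \leq t < r$, $r < C$, and $t \leq C - r$. Then, as an identity of rational numbers, $\frac{1}{t!\binom{C}{t}}\Big[(t-1)!\binom{C-1}{t-1} + \sum_{b=1}^{t-1} \frac{t!}{(t-b)(t-b+1)}\Big(\binom{C-1}{t-1} - \sum_{i=1}^{b}\binom{r-1}{t-i}\binom{C-r}{i-1}\Big)\Big] = \frac{t}{C} - \frac{1}{\binom{C}{t}} \sum_{i=1}^{t-1} \frac{t-i}{r}\binom{r}{t-i+1}\binom{C-r}{i-1}$. -/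
/-- Summation by parts against the telescoping weights `1 / ((t - b) * (t - b + 1))`. -/
theorem sum_telescoping_weight_mul_sub_sum (t : ℕ) (X : ℚ) (a : ℕ → ℚ) (n : ℕ) (hn : n < t) :
    ∑ b ∈ Finset.Icc 1 n, 1 / (((t : ℚ) - (b : ℚ)) * ((t : ℚ) - (b : ℚ) + 1)) *
        (X - ∑ i ∈ Finset.Icc 1 b, a i)
      = (X - ∑ i ∈ Finset.Icc 1 n, a i) / ((t : ℚ) - n) - X / t
        + ∑ i ∈ Finset.Icc 1 n, a i / ((t : ℚ) - (i : ℚ) + 1) := by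
  induction n with
  | zero => simp
  | succ n ih =>
    have h : (n : ℚ) + 1 < t := by exact_mod_cast hn
    rw [Finset.sum_Icc_succ_top (by omega), ih (by omega),
      Finset.sum_Icc_succ_top (by omega) (fun i => a i / ((t : ℚ) - (i : ℚ) + 1)),
      Finset.sum_Icc_succ_top (by omega) a]
    generalize ∑ i ∈ Finset.Icc 1 n, a i = S
    generalize ∑ i ∈ Finset.Icc 1 n, a i / ((t : ℚ) - (i : ℚ) + 1) = T
    push_cast
    have h1 : (t : ℚ) - (n + 1) ≠ 0 := by linarith
    have h2 : (t : ℚ) - n ≠ 0 := by linarith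
    have h3 : (t : ℚ) - (n + 1) + 1 = t - n := by ring
    rw [h3]
    have h4 : 1 / (((t : ℚ) - (n + 1)) * (t - n)) = 1 / ((t : ℚ) - (n + 1)) - 1 / (t - n) := by
      field_simp
      ring
    rw [h4]
    ring


/-- Normalized cache memory of Scheme 1, case `t < r` (equation (8) in the paper):
the round-by-round count of mini-subfiles equals the closed form of Theorem 1. -/
theorem scheme1_memory_t_lt_r (C r t : ℕ) (ht : 1 ≤ t) (htr : t < r) (hrC : r < C)
    (htC : t + r ≤ C) :
    (1 / ((Nat.factorial t : ℚ) * (C.choose t : ℚ))) *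
      ((Nat.factorial (t - 1) : ℚ) * ((C - 1).choose (t - 1) : ℚ) +
        ∑ b ∈ Finset.Icc 1 (t - 1),
          (Nat.factorial t : ℚ) / (((t : ℚ) - (b : ℚ)) * ((t : ℚ) - (b : ℚ) + 1)) *
            (((C - 1).choose (t - 1) : ℚ) -
              ∑ i ∈ Finset.Icc 1 b,
                ((r - 1).choose (t - i) : ℚ) * ((C - r).choose (i - 1) : ℚ)))
      = (t : ℚ) / (C : ℚ) - (1 / (C.choose t : ℚ)) *
          ∑ i ∈ Finset.Icc 1 (t - 1),
            (((t : ℚ) - (i : ℚ)) / (r : ℚ)) * (r.choose (t - i + 1) : ℚ) *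
              ((C - r).choose (i - 1) : ℚ) := by
  have hC : (C : ℚ) ≠ 0 := by
    have : C ≠ 0 := by omega
    exact_mod_cast this
  have hr : (r : ℚ) ≠ 0 := by
    have : r ≠ 0 := by omega
    exact_mod_cast this
  have hchoose : (C.choose t : ℚ) ≠ 0 := by
    exact_mod_cast (Nat.choose_pos (by omega : t ≤ C)).ne'
  have hfact : (Nat.factorial t : ℚ) ≠ 0 := by exact_mod_cast t.factorial_ne_zero
  have ht0 : (t : ℚ) ≠ 0 := by
    have : t ≠ 0 := by omega
    exact_mod_cast this
  have hX : (C : ℚ) * ((C - 1).choose (t - 1) : ℚ) = (C.choose t : ℚ) * t := by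
    have h := Nat.add_one_mul_choose_eq (C - 1) (t - 1)
    rw [Nat.sub_add_cancel (by omega : 1 ≤ C), Nat.sub_add_cancel ht] at h
    exact_mod_cast h
  have hft : (Nat.factorial (t - 1) : ℚ) = (Nat.factorial t : ℚ) * (1 / t) := by
    rw [← Nat.mul_factorial_pred (by omega : t ≠ 0)]
    push_cast
    field_simp
  have hsum := sum_telescoping_weight_mul_sub_sum t ((C - 1).choose (t - 1))
    (fun i => ((r - 1).choose (t - i) : ℚ) * ((C - r).choose (i - 1) : ℚ)) (t - 1) (by omega)
  have hlast : (t : ℚ) - ((t - 1 : ℕ) : ℚ) = 1 := by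
    rw [Nat.cast_sub ht]
    simp
  rw [hlast, div_one] at hsum
  have hterms : ∑ i ∈ Finset.Icc 1 (t - 1), (((t : ℚ) - (i : ℚ)) / (r : ℚ)) *
        (r.choose (t - i + 1) : ℚ) * ((C - r).choose (i - 1) : ℚ)
      = ∑ i ∈ Finset.Icc 1 (t - 1), ((r - 1).choose (t - i) : ℚ) * ((C - r).choose (i - 1) : ℚ)
        - ∑ i ∈ Finset.Icc 1 (t - 1), ((r - 1).choose (t - i) : ℚ) *
          ((C - r).choose (i - 1) : ℚ) / ((t : ℚ) - (i : ℚ) + 1) := by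
    rw [← Finset.sum_sub_distrib]
    refine Finset.sum_congr rfl fun i hi => ?_
    have hit : i ≤ t := by
      have := (Finset.mem_Icc.mp hi).2
      omega
    have h := Nat.add_one_mul_choose_eq (r - 1) (t - i)
    rw [Nat.sub_add_cancel (by omega : 1 ≤ r)] at h
    have h' : (r : ℚ) * ((r - 1).choose (t - i) : ℚ)
        = (r.choose (t - i + 1) : ℚ) * ((t : ℚ) - i + 1) := by
      rw [← Nat.cast_sub hit]
      exact_mod_cast h
    have hpos : (t : ℚ) - i + 1 ≠ 0 := by
      rw [← Nat.cast_sub hit]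
      positivity
    have hquot : ((r - 1).choose (t - i) : ℚ)
        = (r.choose (t - i + 1) : ℚ) * ((t : ℚ) - i + 1) / r :=
      eq_div_of_mul_eq hr (by rw [mul_comm]; exact h')
    rw [hquot]
    field_simp
    ring
  have hscale : ∑ b ∈ Finset.Icc 1 (t - 1),
        (Nat.factorial t : ℚ) / (((t : ℚ) - (b : ℚ)) * ((t : ℚ) - (b : ℚ) + 1)) *
          (((C - 1).choose (t - 1) : ℚ) - ∑ i ∈ Finset.Icc 1 b,
            ((r - 1).choose (t - i) : ℚ) * ((C - r).choose (i - 1) : ℚ))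
      = (Nat.factorial t : ℚ) * ∑ b ∈ Finset.Icc 1 (t - 1),
        1 / (((t : ℚ) - (b : ℚ)) * ((t : ℚ) - (b : ℚ) + 1)) *
          (((C - 1).choose (t - 1) : ℚ) - ∑ i ∈ Finset.Icc 1 b,
            ((r - 1).choose (t - i) : ℚ) * ((C - r).choose (i - 1) : ℚ)) := by
    rw [Finset.mul_sum]
    exact Finset.sum_congr rfl fun b _ => by ring
  have hratio : (t : ℚ) / C = 1 / (C.choose t : ℚ) * ((C - 1).choose (t - 1) : ℚ) := by
    field_simp
    linarith
  rw [hscale, hsum, hterms, hft, hratio]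
  field_simp
  ring
end

section
/- For all integers $r, C$ with $1 \leq r < C$ and $C \geq 2r - 1$, one has $\frac{C-r+1}{C} - \frac{1}{r\binom{C}{r-1}} \sum_{i=1}^{r-1} (r-i)\binom{r}{i-1}\binom{C-r}{r-i} = \frac{1}{r}$ as an equality of rational numbers. -/
/-- A weighted Vandermonde identity: weighting by the lower index of the second factor. -/
theorem sum_range_sub_mul_choose_mul_choose (p n j : ℕ) :
    ∑ a ∈ Finset.range (j + 1), (j + 1 - a) * p.choose a * (n + 1).choose (j + 1 - a) =
      (n + 1) * (p + n).choose j := by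
  rw [Nat.add_choose_eq, Finset.Nat.sum_antidiagonal_eq_sum_range_succ_mk, Finset.mul_sum]
  refine Finset.sum_congr rfl fun a ha => ?_
  obtain ⟨b, rfl⟩ := Nat.exists_eq_add_of_le (Finset.mem_range_succ_iff.mp ha)
  have h1 : a + b + 1 - a = b + 1 := by omega
  have h2 : a + b - a = b := by omega
  simp only [h1, h2]
  rw [mul_right_comm, mul_comm (b + 1), ← Nat.add_one_mul_choose_eq]
  ring

/-- For `1 ≤ r < C` with `C ≥ 2r - 1`:
`(C-r+1)/C - (1/(r C(C,r-1))) ∑_{i=1}^{r-1} (r-i) C(r,i-1) C(C-r,r-i) = 1/r`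
as rational numbers. -/
theorem memory_at_t_eq_C_sub_r_add_one_ge_case (r C : ℕ) (hr : 1 ≤ r) (hrC : r < C)
    (hC : 2 * r - 1 ≤ C) :
    ((C : ℚ) - (r : ℚ) + 1) / (C : ℚ) -
        (1 / ((r : ℚ) * (C.choose (r - 1) : ℚ))) *
          ∑ i ∈ Finset.Icc 1 (r - 1),
            ((r : ℚ) - (i : ℚ)) * (r.choose (i - 1) : ℚ) * ((C - r).choose (r - i) : ℚ)
      = 1 / (r : ℚ) := by
  obtain ⟨n, rfl⟩ : ∃ n, C = r + n + 1 := Nat.exists_eq_add_of_lt hrC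
  obtain ⟨s, rfl⟩ : ∃ s, r = s + 1 := Nat.exists_eq_add_of_le' hr
  rcases s with _ | j
  · have : 1 + (n : ℚ) + 1 ≠ 0 := by positivity
    simpa using this
  have hsum : ∑ i ∈ Finset.Icc 1 (j + 1 + 1 - 1), (((j + 1 + 1 : ℕ) : ℚ) - (i : ℚ)) *
      ((j + 1 + 1).choose (i - 1) : ℚ) *
      ((j + 1 + 1 + n + 1 - (j + 1 + 1)).choose (j + 1 + 1 - i) : ℚ) =
      (n + 1) * ((j + 2 + n).choose j : ℚ) := by
    have h := congrArg (Nat.cast : ℕ → ℚ) (sum_range_sub_mul_choose_mul_choose (j + 2) n j)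
    push_cast at h
    rw [← h, Nat.add_sub_cancel, ← Finset.Ico_add_one_right_eq_Icc, Finset.sum_Ico_eq_sum_range]
    refine Finset.sum_congr (by simp) fun a ha => ?_
    have ha' : a ≤ j := by simp at ha; omega
    have h1 : j + 1 + 1 + n + 1 - (j + 1 + 1) = n + 1 := by omega
    have h2 : j + 1 + 1 - (1 + a) = j + 1 - a := by omega
    have h3 : 1 + a - 1 = a := by omega
    rw [h1, h2, h3, Nat.cast_sub (by omega : a ≤ j + 1)]
    push_cast
    ring
  have hchoose : ((j + 2 + n : ℕ) + 1 : ℚ) * (j + 2 + n).choose j =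
      (j + 1 + 1 + n + 1).choose (j + 1) * (j + 1) := by
    exact_mod_cast Nat.add_one_mul_choose_eq (j + 2 + n) j
  have hpos : ((j + 1 + 1 + n + 1).choose (j + 1) : ℚ) ≠ 0 :=
    Nat.cast_ne_zero.mpr (Nat.choose_pos (by omega)).ne'
  rw [hsum, Nat.add_sub_cancel]
  generalize ((j + 1 + 1 + n + 1).choose (j + 1) : ℚ) = x at *
  generalize ((j + 2 + n).choose j : ℚ) = y at *
  push_cast at *
  have hr0 : (j : ℚ) + 1 + 1 ≠ 0 := by positivity
  have hC0 : (j : ℚ) + 1 + 1 + n + 1 ≠ 0 := by positivity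
  field_simp
  linear_combination (-(n + 1 : ℚ)) * hchoose
end

section
/- Let $r, C$ be integers with $1 \leq r \leq C < 2r - 1$, and set $t = C - r + 1$ (so that $1 \leq t < r$). Then $\sum_{i=1}^{t-1} (t-i)\binom{r}{t-i+1}\binom{C-r}{i-1} = \frac{rt}{C}\binom{C}{t} - \binom{C}{t}$ as an equality of rational numbers. -/
open Finset in
theorem Nat.sum_antidiagonal_mul_choose_mul_choose (r n k : ℕ) :
    ∑ p ∈ antidiagonal (k + 1), p.1 * (r + 1).choose p.1 * n.choose p.2
      = (r + 1) * (r + n).choose k := by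
  rw [Nat.sum_antidiagonal_succ, Nat.add_choose_eq r n k, Finset.mul_sum]
  simp only [zero_mul, zero_add]
  refine Finset.sum_congr rfl fun p _ => ?_
  rw [← mul_assoc, Nat.add_one_mul_choose_eq, mul_comm (p.1 + 1)]

open Finset in
theorem Finset.sum_Icc_sub_mul_choose_mul_choose (r n : ℕ) :
    ∑ i ∈ Icc 1 n, (((n + 1 : ℕ) : ℚ) - i) * (r.choose (n + 1 - i + 1) : ℚ)
        * (n.choose (i - 1) : ℚ)
      = ∑ p ∈ antidiagonal (n + 1), ((p.1 : ℚ) - 1) * (r.choose p.1 : ℚ) * (n.choose p.2 : ℚ) := by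
  rw [Nat.sum_antidiagonal_eq_sum_range_succ_mk, sum_range_succ', sum_range_succ']
  simp only [Nat.sub_zero, Nat.choose_succ_self, Nat.cast_zero, mul_zero, add_zero, zero_add,
    Nat.cast_one, sub_self, zero_mul]
  refine sum_nbij' (fun i => n - i) (fun m => n - m) ?_ ?_ ?_ ?_ ?_
  · intro i hi; simp only [mem_Icc, mem_range] at *; omega
  · intro i hi; simp only [mem_Icc, mem_range] at *; omega
  · intro i hi; simp only [mem_Icc] at *; omega
  · intro i hi; simp only [mem_range] at *; omega
  · intro i hi
    rw [mem_Icc] at hi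
    rw [show n + 1 - i + 1 = n - i + 1 + 1 by omega,
      show n + 1 - (n - i + 1 + 1) = i - 1 by omega]
    push_cast [hi.2]
    ring


/-- For `1 ≤ r ≤ C < 2r - 1` and `t = C - r + 1`:
`∑_{i=1}^{t-1} (t-i) C(r, t-i+1) C(C-r, i-1) = (r t / C) C(C,t) - C(C,t)`
as rational numbers. -/
theorem weighted_sum_t_lt_r_at_C_sub_r_add_one (r C t : ℕ) (hr : 1 ≤ r) (hrC : r ≤ C)
    (hC : C < 2 * r - 1) (ht : t = C - r + 1) :
    ∑ i ∈ Finset.Icc 1 (t - 1),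
        ((t : ℚ) - (i : ℚ)) * (r.choose (t - i + 1) : ℚ) * ((C - r).choose (i - 1) : ℚ)
      = (r : ℚ) * (t : ℚ) / (C : ℚ) * (C.choose t : ℚ) - (C.choose t : ℚ) := by
  obtain ⟨n, rfl⟩ := Nat.exists_eq_add_of_le hrC
  obtain ⟨s, rfl⟩ := Nat.exists_eq_add_of_le' hr
  rw [Nat.add_sub_cancel_left] at ht ⊢
  subst ht
  rw [Nat.add_sub_cancel, Finset.sum_Icc_sub_mul_choose_mul_choose]
  have weighted : (∑ p ∈ Finset.HasAntidiagonal.antidiagonal (n + 1),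
      (p.1 : ℚ) * ((s + 1).choose p.1 : ℚ) * (n.choose p.2 : ℚ))
        = ((s + 1 : ℕ) : ℚ) * ((s + n).choose n : ℚ) := by
    exact_mod_cast Nat.sum_antidiagonal_mul_choose_mul_choose s n n
  have vandermonde : (∑ p ∈ Finset.HasAntidiagonal.antidiagonal (n + 1),
      ((s + 1).choose p.1 : ℚ) * (n.choose p.2 : ℚ)) = ((s + 1 + n).choose (n + 1) : ℚ) := by
    exact_mod_cast (Nat.add_choose_eq (s + 1) n (n + 1)).symm
  have absorption : ((s + 1 + n : ℕ) : ℚ) * ((s + n).choose n : ℚ)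
      = ((s + 1 + n).choose (n + 1) : ℚ) * ((n + 1 : ℕ) : ℚ) := by
    rw [show s + 1 + n = s + n + 1 by omega]
    exact_mod_cast Nat.add_one_mul_choose_eq (s + n) n
  simp only [sub_mul, one_mul, Finset.sum_sub_distrib]
  rw [weighted, vandermonde]
  have C_ne_zero : ((s + 1 + n : ℕ) : ℚ) ≠ 0 := Nat.cast_ne_zero.mpr (by omega)
  congr 1
  rw [div_mul_eq_mul_div, eq_div_iff C_ne_zero]
  linear_combination ((s + 1 : ℕ) : ℚ) * absorption
end

section
/- For all integers $r, C$ with $1 \leq r$ and $C \geq 2r$, the identity $\sum_{i=1}^{r-1} (r-i)\binom{r}{i-1}\binom{C-r}{r-i+1} = \frac{r(C-r)}{C}\binom{C}{r} - \binom{C}{r} + 1$ holds as an equality of rational numbers. -/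
theorem sum_antidiagonal_choose_mul_snd_mul_choose (a k m : ℕ) :
    ∑ p ∈ Finset.HasAntidiagonal.antidiagonal (m + 1), a.choose p.1 * (p.2 * (k + 1).choose p.2)
      = (k + 1) * (a + k).choose m := by
  rw [Finset.Nat.sum_antidiagonal_succ', Nat.add_choose_eq a k, Finset.mul_sum]
  simp only [zero_mul, mul_zero, zero_add]
  refine Finset.sum_congr rfl fun p _ => ?_
  rw [mul_comm (p.2 + 1), ← Nat.add_one_mul_choose_eq]
  ring

/-- For `r ≥ 1` and `C ≥ 2r`:
`∑_{i=1}^{r-1} (r-i) C(r,i-1) C(C-r,r-i+1) = (r(C-r)/C) C(C,r) - C(C,r) + 1`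
as rational numbers. -/
theorem weighted_sum_at_t_eq_C_sub_r (r C : ℕ) (hr : 1 ≤ r) (hC : 2 * r ≤ C) :
    ∑ i ∈ Finset.Icc 1 (r - 1),
        ((r : ℚ) - (i : ℚ)) * (r.choose (i - 1) : ℚ) * ((C - r).choose (r - i + 1) : ℚ)
      = (r : ℚ) * ((C : ℚ) - (r : ℚ)) / (C : ℚ) * (C.choose r : ℚ) - (C.choose r : ℚ) + 1 := by
  obtain ⟨m, rfl⟩ : ∃ m, r = m + 1 := ⟨r - 1, by omega⟩
  obtain ⟨k, rfl⟩ : ∃ k, C = m + 1 + (k + 1) := ⟨C - m - 2, by omega⟩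
  have weighted := sum_antidiagonal_choose_mul_snd_mul_choose (m + 1) k m
  have vandermonde := Nat.add_choose_eq (m + 1) (k + 1) (m + 1)
  have absorb := Nat.add_one_mul_choose_eq (m + 1 + k) m
  rw [Finset.Nat.sum_antidiagonal_eq_sum_range_succ_mk] at weighted vandermonde
  have reindex : ∑ i ∈ Finset.Icc 1 (m + 1 - 1), (((m + 1 : ℕ) : ℚ) - (i : ℚ)) *
        ((m + 1).choose (i - 1) : ℚ) * ((m + 1 + (k + 1) - (m + 1)).choose (m + 1 - i + 1) : ℚ)
      = ∑ j ∈ Finset.range m, (((m + 1).choose j * ((m + 1 - j : ℕ) *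
          (k + 1).choose (m + 1 - j)) : ℚ) - (m + 1).choose j * (k + 1).choose (m + 1 - j)) := by
    rw [← Finset.Ico_add_one_right_eq_Icc, Finset.sum_Ico_eq_sum_range]
    refine Finset.sum_congr (by simp) fun j hj => ?_
    have hj : j < m := by simpa using hj
    rw [show m + 1 - (1 + j) + 1 = m + 1 - j by omega, Nat.add_sub_cancel_left,
      Nat.add_sub_cancel_left, Nat.cast_sub (by omega : j ≤ m + 1)]
    push_cast
    ring
  rw [reindex, Finset.sum_sub_distrib]
  simp only [Finset.sum_range_succ, Nat.sub_self, Nat.add_sub_cancel_left, Nat.choose_self,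
    Nat.choose_zero_right, Nat.choose_one_right, mul_zero, one_mul, mul_one,
    add_zero] at weighted vandermonde
  rw [← add_assoc] at vandermonde ⊢
  qify at weighted vandermonde absorb
  have closed : ((m + 1 : ℕ) : ℚ) * (((m + 1 + k + 1 : ℕ) : ℚ) - ((m + 1 : ℕ) : ℚ)) /
      ((m + 1 + k + 1 : ℕ) : ℚ) * ((m + 1 + k + 1).choose (m + 1) : ℚ)
      = (k + 1) * (m + 1 + k).choose m := by
    push_cast
    field_simp
    linear_combination (-(k + 1 : ℚ)) * absorb
  rw [closed]
  simp only [Nat.add_sub_cancel_left, Nat.cast_add, Nat.cast_one] at *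
  linear_combination weighted + vandermonde
end

section
/- Let $r, C$ be integers with $1 \leq r < C < 2r$, and set $t = C - r$ (so that $1 \leq t < r$). Then $\sum_{i=1}^{t-1} (t-i)\binom{r}{t-i+1}\binom{C-r}{i-1} = \frac{r(C-r)}{C}\binom{C}{r} - \binom{C}{r} + 1$ as an equality of rational numbers. -/
/-- A shifted Vandermonde sum in which each term is weighted by a summation index. -/
theorem sum_range_weighted_choose_mul_choose (q s : ℕ) :
    ∑ j ∈ Finset.range (s + 1),
        ((s : ℚ) - j) * ((q + 1).choose (s - j + 1) : ℚ) * ((s + 1).choose j : ℚ)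
      = (q + 1) * ((s + 1 + q).choose s : ℚ) - ((s + 1 + (q + 1)).choose (s + 1) : ℚ) + 1 := by
  rw [Nat.add_choose_eq (s + 1) q s, Nat.add_choose_eq (s + 1) (q + 1) (s + 1),
    Finset.Nat.sum_antidiagonal_eq_sum_range_succ_mk,
    Finset.Nat.sum_antidiagonal_eq_sum_range_succ_mk, Finset.sum_range_succ _ (s + 1)]
  push_cast
  simp only [Nat.choose_self, Nat.sub_self, Nat.choose_zero_right, Nat.cast_one, mul_one]
  rw [sub_add_eq_sub_sub, sub_add_cancel, Finset.mul_sum, ← Finset.sum_sub_distrib]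
  refine Finset.sum_congr rfl fun j hj => ?_
  have hjs : j ≤ s := Nat.lt_succ_iff.mp (Finset.mem_range.mp hj)
  have h : ((q : ℚ) + 1) * (q.choose (s - j) : ℚ)
      = ((q + 1).choose (s - j + 1) : ℚ) * ((s : ℚ) - j + 1) := by
    rw [← Nat.cast_sub hjs]
    exact_mod_cast Nat.add_one_mul_choose_eq q (s - j)
  rw [Nat.sub_add_comm hjs]
  linear_combination (-((s + 1).choose j : ℚ)) * h


/-- For `1 ≤ r < C < 2r` and `t = C - r`:
`∑_{i=1}^{t-1} (t-i) C(r,t-i+1) C(C-r,i-1) = (r(C-r)/C) C(C,r) - C(C,r) + 1`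
as rational numbers. -/
theorem weighted_sum_at_t_eq_C_sub_r_lt_case (r C t : ℕ) (hr : 1 ≤ r) (hrC : r < C)
    (hC : C < 2 * r) (ht : t = C - r) :
    ∑ i ∈ Finset.Icc 1 (t - 1),
        ((t : ℚ) - (i : ℚ)) * (r.choose (t - i + 1) : ℚ) * ((C - r).choose (i - 1) : ℚ)
      = (r : ℚ) * ((C : ℚ) - (r : ℚ)) / (C : ℚ) * (C.choose r : ℚ) - (C.choose r : ℚ) + 1 := by
  obtain ⟨q, rfl⟩ : ∃ q, r = q + 1 := ⟨r - 1, by omega⟩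
  obtain ⟨s, rfl⟩ : ∃ s, C = s + 1 + (q + 1) := ⟨C - (q + 1) - 1, by omega⟩
  obtain rfl : t = s + 1 := by omega
  have hsum : ∑ i ∈ Finset.Icc 1 (s + 1 - 1),
      (((s + 1 : ℕ) : ℚ) - (i : ℚ)) * ((q + 1).choose (s + 1 - i + 1) : ℚ)
        * ((s + 1 + (q + 1) - (q + 1)).choose (i - 1) : ℚ)
      = ∑ j ∈ Finset.range (s + 1),
        ((s : ℚ) - j) * ((q + 1).choose (s - j + 1) : ℚ) * ((s + 1).choose j : ℚ) := by
    rw [Finset.sum_range_succ, sub_self, zero_mul, zero_mul, add_zero, Nat.add_sub_cancel,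
      Nat.add_sub_cancel, ← Finset.Ico_add_one_right_eq_Icc, Finset.sum_Ico_eq_sum_range,
      Nat.add_sub_cancel]
    refine Finset.sum_congr rfl fun j _ => ?_
    rw [show s + 1 - (1 + j) = s - j by omega, Nat.add_sub_cancel_left]
    push_cast
    ring
  have habsorb : ((s : ℚ) + 1 + (q + 1)) * ((s + 1 + q).choose s : ℚ)
      = ((s + 1 + (q + 1)).choose (s + 1) : ℚ) * (s + 1) := by
    exact_mod_cast Nat.add_one_mul_choose_eq (s + 1 + q) s
  have hC0 : (s : ℚ) + 1 + (q + 1) ≠ 0 := by positivity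
  rw [hsum, sum_range_weighted_choose_mul_choose, Nat.choose_symm_add (a := s + 1) (b := q + 1)]
  rw [Nat.choose_symm_add (a := s + 1) (b := q + 1)] at habsorb
  push_cast
  field_simp
  linear_combination ((q : ℚ) + 1) * habsorb
end

section
/- Let $r, C$ be integers with $1 \leq r < C < 2r$, and set $t = C - r$ (so that $1 \leq t < r$). Then $\frac{\binom{C-1}{t-1}}{\binom{C}{r}} - \frac{1}{r\binom{C}{r}} \sum_{i=1}^{t-1} (t-i)\binom{r}{t-i+1}\binom{C-r}{i-1} = \frac{\binom{C}{r} - 1}{r\binom{C}{r}}$ as an equality of rational numbers. -/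
theorem choose_add_eq_sum_range (m n k : ℕ) :
    (m + n).choose k = ∑ j ∈ Finset.range (k + 1), m.choose (k - j) * n.choose j := by
  rw [add_comm, Nat.add_choose_eq, Finset.Nat.sum_antidiagonal_eq_sum_range_succ_mk]
  exact Finset.sum_congr rfl fun _ _ => mul_comm _ _

/-- A weighted Vandermonde identity. -/
theorem sum_sub_mul_choose_mul_choose (r n s : ℕ) :
    ∑ j ∈ Finset.range (s + 1),
        ((s : ℚ) + 1 - j) * ((r + 1).choose (s + 1 - j) : ℚ) * (n.choose j : ℚ)
      = (r + 1) * ((r + n).choose s : ℚ) := by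
  rw [choose_add_eq_sum_range, Nat.cast_sum, Finset.mul_sum]
  refine Finset.sum_congr rfl fun j hj => ?_
  obtain ⟨k, rfl⟩ := Nat.exists_eq_add_of_le (Finset.mem_range_succ_iff.mp hj)
  have h : ((r : ℚ) + 1) * (r.choose k : ℚ) = ((r + 1).choose (k + 1) : ℚ) * (k + 1) := by
    exact_mod_cast Nat.add_one_mul_choose_eq r k
  rw [show j + k + 1 - j = k + 1 by omega, show j + k - j = k by omega]
  push_cast
  linear_combination -(n.choose j : ℚ) * h

theorem sum_sub_mul_choose_mul_choose_self (r s : ℕ) :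
    ∑ j ∈ Finset.range s,
        ((s : ℚ) - j) * ((r + 1).choose (s + 1 - j) : ℚ) * ((s + 1).choose j : ℚ)
      = (r + 1) * ((r + (s + 1)).choose s : ℚ) - ((r + 1 + (s + 1)).choose (s + 1) : ℚ) + 1 := by
  have h := sum_sub_mul_choose_mul_choose r (s + 1) s
  have hv : ((r + 1 + (s + 1)).choose (s + 1) : ℚ) = ∑ j ∈ Finset.range (s + 1),
      ((r + 1).choose (s + 1 - j) : ℚ) * ((s + 1).choose j : ℚ) + 1 := by
    rw [choose_add_eq_sum_range, Finset.sum_range_succ]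
    simp
  have hs : ∑ j ∈ Finset.range s,
        ((s : ℚ) - j) * ((r + 1).choose (s + 1 - j) : ℚ) * ((s + 1).choose j : ℚ)
      = ∑ j ∈ Finset.range (s + 1),
        ((s : ℚ) - j) * ((r + 1).choose (s + 1 - j) : ℚ) * ((s + 1).choose j : ℚ) := by
    simp [Finset.sum_range_succ]
  rw [hv, ← h, hs, sub_add_eq_sub_sub, sub_add_cancel, ← Finset.sum_sub_distrib]
  exact Finset.sum_congr rfl fun j _ => by ring

/-- For `1 ≤ r < C < 2r` and `t = C - r`:
`C(C-1,t-1)/C(C,r) - (1/(r C(C,r))) ∑_{i=1}^{t-1} (t-i) C(r,t-i+1) C(C-r,i-1)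
  = (C(C,r) - 1)/(r C(C,r))` as rational numbers. -/
theorem memory_at_t_eq_C_sub_r_lt_case (r C t : ℕ) (hr : 1 ≤ r) (hrC : r < C)
    (hC : C < 2 * r) (ht : t = C - r) :
    ((C - 1).choose (t - 1) : ℚ) / (C.choose r : ℚ) -
        (1 / ((r : ℚ) * (C.choose r : ℚ))) *
          ∑ i ∈ Finset.Icc 1 (t - 1),
            ((t : ℚ) - (i : ℚ)) * (r.choose (t - i + 1) : ℚ) * ((C - r).choose (i - 1) : ℚ)
      = ((C.choose r : ℚ) - 1) / ((r : ℚ) * (C.choose r : ℚ)) := by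
  obtain ⟨r, rfl⟩ := Nat.exists_eq_add_of_le' hr
  obtain ⟨s, rfl⟩ := Nat.exists_eq_add_of_lt hrC
  obtain rfl : t = s + 1 := by omega
  have hsum : ∑ i ∈ Finset.Icc 1 (s + 1 - 1),
        (((s + 1 : ℕ) : ℚ) - (i : ℚ)) * ((r + 1).choose (s + 1 - i + 1) : ℚ)
          * ((r + 1 + s + 1 - (r + 1)).choose (i - 1) : ℚ)
      = (r + 1) * ((r + (s + 1)).choose s : ℚ)
        - ((r + 1 + (s + 1)).choose (s + 1) : ℚ) + 1 := by
    rw [← sum_sub_mul_choose_mul_choose_self, Finset.range_eq_Ico, Finset.sum_Ico_eq_sum_range,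
      ← Finset.Ico_add_one_right_eq_Icc, Finset.sum_Ico_eq_sum_range]
    refine Finset.sum_congr (by simp) fun j hj => ?_
    have hj' : j < s := by simpa using hj
    rw [show s + 1 - (1 + j) + 1 = s + 1 - (0 + j) by omega,
      show r + 1 + s + 1 - (r + 1) = s + 1 by omega, show 1 + j - 1 = 0 + j by omega]
    push_cast
    ring
  rw [hsum, show r + 1 + s + 1 - 1 = r + (s + 1) by omega, Nat.add_sub_cancel,
    show r + 1 + s + 1 = r + 1 + (s + 1) by omega, Nat.choose_symm_add]
  have hpos : ((r + 1 + (s + 1)).choose (s + 1) : ℚ) ≠ 0 := by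
    exact_mod_cast (Nat.choose_pos (by omega)).ne'
  have hr0 : (r : ℚ) + 1 ≠ 0 := by positivity
  push_cast
  field_simp
  ring
end

section
/- Let $C, r, t$ be integers with $2 \leq t < r < C$ and $t \leq C - r + 1$. Then $\sum_{i=1}^{t-1} \frac{t-i}{r}\binom{r}{t-i+1}\binom{C-r}{i-1} > 0$ (as a rational number); consequently, the normalized cache memory $\frac{t}{C} - \frac{1}{\binom{C}{t}}\sum_{i=1}^{t-1} \frac{t-i}{r}\binom{r}{t-i+1}\binom{C-r}{i-1}$ of Scheme 1 is strictly smaller than $\frac{t}{C}$. -/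
/-- For `2 ≤ t < r < C` with `t ≤ C - r + 1`, the correction term in the memory
expression of Scheme 1 (case `t < r`) is strictly positive, so the normalized
memory of Scheme 1 is strictly smaller than `t/C` (the memory of the MKR scheme). -/
theorem scheme1_memory_lt_mkr_t_lt_r (C r t : ℕ) (ht : 2 ≤ t) (htr : t < r)
    (hrC : r < C) (htC : t + r ≤ C + 1) :
    0 < ∑ i ∈ Finset.Icc 1 (t - 1),
          (((t : ℚ) - (i : ℚ)) / (r : ℚ)) * (r.choose (t - i + 1) : ℚ) *
            ((C - r).choose (i - 1) : ℚ) ∧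
    (t : ℚ) / (C : ℚ) - (1 / (C.choose t : ℚ)) *
        ∑ i ∈ Finset.Icc 1 (t - 1),
          (((t : ℚ) - (i : ℚ)) / (r : ℚ)) * (r.choose (t - i + 1) : ℚ) *
            ((C - r).choose (i - 1) : ℚ)
      < (t : ℚ) / (C : ℚ) := by
  have hpos : 0 < ∑ i ∈ Finset.Icc 1 (t - 1),
      (((t : ℚ) - (i : ℚ)) / (r : ℚ)) * (r.choose (t - i + 1) : ℚ) *
        ((C - r).choose (i - 1) : ℚ) := by
    refine Finset.sum_pos (fun i hi => ?_) ⟨1, Finset.mem_Icc.mpr ⟨le_rfl, by omega⟩⟩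
    obtain ⟨hi_one, hi_le⟩ := Finset.mem_Icc.mp hi
    have hit : (i : ℚ) < t := by exact_mod_cast (by omega : i < t)
    have hr : (0 : ℚ) < r := by exact_mod_cast (by omega : 0 < r)
    have hleft : (0 : ℚ) < r.choose (t - i + 1) := by
      exact_mod_cast Nat.choose_pos (by omega)
    have hright : (0 : ℚ) < (C - r).choose (i - 1) := by
      exact_mod_cast Nat.choose_pos (by omega)
    exact mul_pos (mul_pos (div_pos (sub_pos.mpr hit) hr) hleft) hright
  have hchoose : (0 : ℚ) < C.choose t := by
    exact_mod_cast Nat.choose_pos (by omega)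
  exact ⟨hpos, sub_lt_self _ (mul_pos (one_div_pos.mpr hchoose) hpos)⟩
end
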